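/- Up to conjugation, $W(E_6)$ has a unique subgroup of index $27$: the stabilizer $H_0=\{w\in W(E_6): w(f_6)=f_6\}$ of the exceptional vector $f_6$ has index $27$ in $W(E_6)$, and every subgroup $H\le W(E_6)$ of index $27$ is conjugate in $W(E_6)$ to $H_0$. -/

import Mathlib

/-- The symmetric bilinear form on `ℤ^{1,6}`: `⟨x,y⟩ = x₀y₀ - ∑_{i=1}^{6} xᵢyᵢ`. -/
def form (x y : Fin 7 → ℤ) : ℤ := 2 * (x 0 * y 0) - ∑ i, x i * y i

/-- The standard basis vector `f i`. -/
def fvec (i : Fin 7) : Fin 7 → ℤ := fun j => if j = i then 1 else 0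

/-- The canonical vector `k = -3f₀ + f₁ + ⋯ + f₆`. -/
def kvec : Fin 7 → ℤ := fun i => if i = 0 then -3 else 1

/-- A root of the `E₆` lattice: `⟨r,k⟩ = 0` and `⟨r,r⟩ = -2`. -/
def IsRoot (r : Fin 7 → ℤ) : Prop := form r kvec = 0 ∧ form r r = -2

/-- An exceptional vector: `⟨ℓ,ℓ⟩ = -1` and `⟨ℓ,k⟩ = -1`. -/
def IsExc (l : Fin 7 → ℤ) : Prop := form l l = -1 ∧ form l kvec = -1

/-- The reflection in a root `r`, as a plain function: `x ↦ x + ⟨x,r⟩ r`. -/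
def reflFun (r : Fin 7 → ℤ) (x : Fin 7 → ℤ) : Fin 7 → ℤ := x + form x r • r

lemma form_add_left (x y z : Fin 7 → ℤ) : form (x + y) z = form x z + form y z := by
  simp only [form, Pi.add_apply, add_mul, Finset.sum_add_distrib]
  ring

lemma form_smul_left (c : ℤ) (x y : Fin 7 → ℤ) : form (c • x) y = c * form x y := by
  simp only [form, Pi.smul_apply, smul_eq_mul, mul_assoc, ← Finset.mul_sum]
  ring

/-- The reflection in a root `r`, as a linear map. -/
def reflL (r : Fin 7 → ℤ) : (Fin 7 → ℤ) →ₗ[ℤ] (Fin 7 → ℤ) where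
  toFun := reflFun r
  map_add' x y := by
    simp only [reflFun, form_add_left, add_smul]
    abel
  map_smul' c x := by
    simp only [reflFun, form_smul_left, mul_smul, RingHom.id_apply, smul_add]

lemma reflFun_invol (r : Fin 7 → ℤ) (hr : IsRoot r) (x : Fin 7 → ℤ) :
    reflFun r (reflFun r x) = x := by
  have h : form (x + form x r • r) r = -form x r := by
    rw [form_add_left, form_smul_left, hr.2]; ring
  unfold reflFun
  rw [h, neg_smul]
  abel

/-- The reflection in a root `r`, as a linear automorphism of `ℤ^{1,6}`. -/
def reflEquiv (r : Fin 7 → ℤ) (hr : IsRoot r) : (Fin 7 → ℤ) ≃ₗ[ℤ] (Fin 7 → ℤ) :=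
  LinearEquiv.ofLinear (reflL r) (reflL r)
    (LinearMap.ext fun x => reflFun_invol r hr x)
    (LinearMap.ext fun x => reflFun_invol r hr x)

/-- The Weyl group `W(E₆)`: the subgroup of `GL(ℤ^{1,6})` generated by the reflections
in the roots of the `E₆` lattice. -/
def WE6 : Subgroup ((Fin 7 → ℤ) ≃ₗ[ℤ] (Fin 7 → ℤ)) :=
  Subgroup.closure {g | ∃ r, ∃ hr : IsRoot r, g = reflEquiv r hr}

/-- The stabilizer `H₀ = {w ∈ W(E₆) : w(f₆) = f₆}` of the exceptional vector `f₆`. -/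
def H0 : Subgroup WE6 := MulAction.stabilizer WE6 (fvec 6)

lemma form_comm (x y : Fin 7 → ℤ) : form x y = form y x := by
  simp only [form, mul_comm]

lemma form_add_right (x y z : Fin 7 → ℤ) : form x (y + z) = form x y + form x z := by
  rw [form_comm, form_add_left, form_comm y, form_comm z]

lemma form_smul_right (c : ℤ) (x y : Fin 7 → ℤ) : form x (c • y) = c * form x y := by
  rw [form_comm, form_smul_left, form_comm y]

lemma form_sub_left (x y z : Fin 7 → ℤ) : form (x - y) z = form x z - form y z := by
  have h := form_add_left (x - y) y z
  rw [sub_add_cancel] at h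
  linarith

lemma form_sub_right (x y z : Fin 7 → ℤ) : form z (x - y) = form z x - form z y := by
  rw [form_comm, form_sub_left, form_comm x, form_comm y]

/-- The reflection in a root as an element of the Weyl group. -/
def rW (r : Fin 7 → ℤ) (hr : IsRoot r) : WE6 :=
  ⟨reflEquiv r hr, Subgroup.subset_closure ⟨r, hr, rfl⟩⟩

lemma rW_smul (r : Fin 7 → ℤ) (hr : IsRoot r) (x : Fin 7 → ℤ) :
    rW r hr • x = reflFun r x := rfl

lemma form_refl (r : Fin 7 → ℤ) (hr : IsRoot r) (x y : Fin 7 → ℤ) :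
    form (reflFun r x) (reflFun r y) = form x y := by
  simp only [reflFun, form_add_left, form_add_right, form_smul_left, form_smul_right, hr.2,
    form_comm r y]
  ring

lemma refl_k (r : Fin 7 → ℤ) (hr : IsRoot r) : reflFun r kvec = kvec := by
  rw [reflFun, form_comm, hr.1, zero_smul, add_zero]

lemma W_inv (w : WE6) : (∀ x y, form (w • x) (w • y) = form x y) ∧ w • kvec = kvec := by
  obtain ⟨w, hw⟩ := w
  change (∀ x y, form (w x) (w y) = form x y) ∧ w kvec = kvec
  unfold WE6 at hw
  induction hw using Subgroup.closure_induction with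
  | mem g hg =>
    obtain ⟨r, hr, rfl⟩ := hg
    exact ⟨form_refl r hr, refl_k r hr⟩
  | one => exact ⟨fun _ _ => rfl, rfl⟩
  | mul a b _ _ ha hb =>
    refine ⟨fun x y => ?_, ?_⟩
    · change form (a (b x)) (a (b y)) = _
      rw [ha.1, hb.1]
    · change a (b kvec) = _
      rw [hb.2, ha.2]
  | inv a _ ha =>
    refine ⟨fun x y => ?_, ?_⟩
    · rw [← ha.1]
      change form (a (a.symm x)) (a (a.symm y)) = _
      simp
    · change a.symm kvec = _
      rw [LinearEquiv.symm_apply_eq, ha.2]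

lemma W_form (w : WE6) (x y : Fin 7 → ℤ) : form (w • x) (w • y) = form x y := (W_inv w).1 x y

lemma W_exc (w : WE6) (x : Fin 7 → ℤ) (h : IsExc x) : IsExc (w • x) := by
  refine ⟨by rw [W_form]; exact h.1, ?_⟩
  conv_lhs => rw [← (W_inv w).2]
  rw [W_form]; exact h.2

/-- The 27 exceptional vectors. -/
def L : Finset (Fin 7 → ℤ) :=
  [![0,1,0,0,0,0,0], ![0,0,1,0,0,0,0], ![0,0,0,1,0,0,0], ![0,0,0,0,1,0,0], ![0,0,0,0,0,1,0],
   ![0,0,0,0,0,0,1],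
   ![1,-1,-1,0,0,0,0], ![1,-1,0,-1,0,0,0], ![1,-1,0,0,-1,0,0], ![1,-1,0,0,0,-1,0],
   ![1,-1,0,0,0,0,-1], ![1,0,-1,-1,0,0,0], ![1,0,-1,0,-1,0,0], ![1,0,-1,0,0,-1,0],
   ![1,0,-1,0,0,0,-1], ![1,0,0,-1,-1,0,0], ![1,0,0,-1,0,-1,0], ![1,0,0,-1,0,0,-1],
   ![1,0,0,0,-1,-1,0], ![1,0,0,0,-1,0,-1], ![1,0,0,0,0,-1,-1],
   ![2,0,-1,-1,-1,-1,-1], ![2,-1,0,-1,-1,-1,-1], ![2,-1,-1,0,-1,-1,-1],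
   ![2,-1,-1,-1,0,-1,-1], ![2,-1,-1,-1,-1,0,-1], ![2,-1,-1,-1,-1,-1,0]].toFinset

instance (v : Fin 7 → ℤ) : Decidable (IsExc v) := inferInstanceAs (Decidable (_ ∧ _))
instance (v : Fin 7 → ℤ) : Decidable (IsRoot v) := inferInstanceAs (Decidable (_ ∧ _))

lemma L_card : L.card = 27 := by decide +kernel
lemma L_exc : ∀ v ∈ L, IsExc v := by decide +kernel

lemma L_0 : ∀ a b c d e f : Fin 2, (a : ℤ) + b + c + d + e + f = 1 →
    (![0, a, b, c, d, e, f] : Fin 7 → ℤ) ∈ L := by decide +kernel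
lemma L_1 : ∀ a b c d e f : Fin 2, (a : ℤ) + b + c + d + e + f = 2 →
    (![1, -a, -b, -c, -d, -e, -f] : Fin 7 → ℤ) ∈ L := by decide +kernel
lemma L_2 : ∀ a b c d e f : Fin 2, (a : ℤ) + b + c + d + e + f = 5 →
    (![2, -a, -b, -c, -d, -e, -f] : Fin 7 → ℤ) ∈ L := by decide +kernel

lemma cq (x : ℤ) : 0 ≤ x * (x - 1) := by
  rcases le_or_gt x 0 with h | h
  · nlinarith
  · nlinarith

lemma cq0 (x : ℤ) (h : x * (x - 1) ≤ 0) : ∃ a : Fin 2, x = a := by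
  have h1 : x * (x - 1) = 0 := le_antisymm h (cq x)
  rcases mul_eq_zero.1 h1 with h2 | h2
  · exact ⟨0, by simpa using h2⟩
  · exact ⟨1, by simp; omega⟩

lemma cqn (x : ℤ) : 0 ≤ x * (x + 1) := by have := cq (-x); linarith

lemma cqn0 (x : ℤ) (h : x * (x + 1) ≤ 0) : ∃ a : Fin 2, x = -a := by
  obtain ⟨a, ha⟩ := cq0 (-x) (by linarith)
  exact ⟨a, by omega⟩

lemma exc_L (v : Fin 7 → ℤ) (h : IsExc v) : v ∈ L := by
  obtain ⟨h1, h2⟩ := h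
  obtain ⟨x, a, b, c, d, e, f, rfl⟩ : ∃ x a b c d e f : ℤ, v = ![x, a, b, c, d, e, f] :=
    ⟨v 0, v 1, v 2, v 3, v 4, v 5, v 6, by ext i; fin_cases i <;> rfl⟩
  have h1' : x * x - (a*a+b*b+c*c+d*d+e*e+f*f) = -1 := by
    simp [form, Fin.sum_univ_succ] at h1
    linarith
  have h2' : a+b+c+d+e+f = 1 - 3 * x := by
    rw [show kvec = ![-3, 1, 1, 1, 1, 1, 1] by decide +kernel] at h2
    simp [form, Fin.sum_univ_succ] at h2
    linarith
  clear h1 h2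
  have key : (a+b+c+d+e+f)^2 ≤ 6 * (a*a+b*b+c*c+d*d+e*e+f*f) := by
    nlinarith [sq_nonneg (a-b), sq_nonneg (a-c), sq_nonneg (a-d), sq_nonneg (a-e),
      sq_nonneg (a-f), sq_nonneg (b-c), sq_nonneg (b-d), sq_nonneg (b-e), sq_nonneg (b-f),
      sq_nonneg (c-d), sq_nonneg (c-e), sq_nonneg (c-f), sq_nonneg (d-e), sq_nonneg (d-f),
      sq_nonneg (e-f)]
  rw [h2'] at key
  have hx0 : 0 ≤ x := by nlinarith
  have hx2 : x ≤ 2 := by nlinarith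
  have A1 := cq a; have A2 := cqn a
  have B1 := cq b; have B2 := cqn b
  have C1 := cq c; have C2 := cqn c
  have D1 := cq d; have D2 := cqn d
  have E1 := cq e; have E2 := cqn e
  have F1 := cq f; have F2 := cqn f
  interval_cases x
  · obtain ⟨a, rfl⟩ := cq0 a (by linarith)
    obtain ⟨b, rfl⟩ := cq0 b (by linarith)
    obtain ⟨c, rfl⟩ := cq0 c (by linarith)
    obtain ⟨d, rfl⟩ := cq0 d (by linarith)
    obtain ⟨e, rfl⟩ := cq0 e (by linarith)
    obtain ⟨f, rfl⟩ := cq0 f (by linarith)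
    exact L_0 _ _ _ _ _ _ (by linarith)
  · obtain ⟨a, rfl⟩ := cqn0 a (by linarith)
    obtain ⟨b, rfl⟩ := cqn0 b (by linarith)
    obtain ⟨c, rfl⟩ := cqn0 c (by linarith)
    obtain ⟨d, rfl⟩ := cqn0 d (by linarith)
    obtain ⟨e, rfl⟩ := cqn0 e (by linarith)
    obtain ⟨f, rfl⟩ := cqn0 f (by linarith)
    exact L_1 _ _ _ _ _ _ (by linarith)
  · obtain ⟨a, rfl⟩ := cqn0 a (by linarith)
    obtain ⟨b, rfl⟩ := cqn0 b (by linarith)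
    obtain ⟨c, rfl⟩ := cqn0 c (by linarith)
    obtain ⟨d, rfl⟩ := cqn0 d (by linarith)
    obtain ⟨e, rfl⟩ := cqn0 e (by linarith)
    obtain ⟨f, rfl⟩ := cqn0 f (by linarith)
    exact L_2 _ _ _ _ _ _ (by linarith)

lemma W_L (w : WE6) (x : Fin 7 → ℤ) (h : x ∈ L) : w • x ∈ L := exc_L _ (W_exc w x (L_exc x h))

/-- Pointwise stabilizer of a list of vectors. -/
def Kf (T : List (Fin 7 → ℤ)) : Subgroup WE6 where
  carrier := {w | ∀ t ∈ T, w • t = t}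
  one_mem' t _ := one_smul _ t
  mul_mem' {a b} ha hb t ht := by rw [mul_smul, hb t ht, ha t ht]
  inv_mem' {a} ha t ht := by rw [inv_smul_eq_iff, ha t ht]

/-- Lines skew to every member of the list. -/
def Sk (T : List (Fin 7 → ℤ)) : Finset (Fin 7 → ℤ) := L.filter fun v => ∀ t ∈ T, form v t = 0

lemma orbit_sub (T : List (Fin 7 → ℤ)) (a : Fin 7 → ℤ) (ha : a ∈ Sk T) :
    MulAction.orbit (Kf T) a ⊆ (Sk T : Set (Fin 7 → ℤ)) := by
  rintro _ ⟨⟨w, hw⟩, rfl⟩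
  have ha' := Finset.mem_filter.1 ha
  refine Finset.mem_coe.2 (Finset.mem_filter.2 ⟨W_L w a ha'.1, fun t ht => ?_⟩)
  change form (w • a) t = 0
  conv_lhs => rw [← hw t ht]
  rw [W_form, ha'.2 t ht]

lemma skew_move (T : List (Fin 7 → ℤ)) (a b : Fin 7 → ℤ) (ha : a ∈ Sk T) (hb : b ∈ Sk T)
    (hab : form a b = 0) : ∃ w ∈ Kf T, w • a = b := by
  have ha' := Finset.mem_filter.1 ha
  have hb' := Finset.mem_filter.1 hb
  have ea := L_exc a ha'.1
  have eb := L_exc b hb'.1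
  have hr : IsRoot (a - b) := by
    refine ⟨?_, ?_⟩
    · rw [form_sub_left, ea.2, eb.2]; rfl
    · rw [form_sub_left, form_sub_right, form_sub_right, ea.1, eb.1, form_comm b a, hab]; rfl
  refine ⟨rW _ hr, fun t ht => ?_, ?_⟩
  · rw [rW_smul, reflFun, form_comm, form_sub_left, ha'.2 t ht, hb'.2 t ht]; simp
  · rw [rW_smul, reflFun, form_sub_right, ea.1, hab]
    simp

lemma orbit_eq (T : List (Fin 7 → ℤ)) (a : Fin 7 → ℤ) (ha : a ∈ Sk T)
    (hc : ∀ b ∈ Sk T, b = a ∨ form a b = 0 ∨ ∃ c ∈ Sk T, form a c = 0 ∧ form c b = 0) :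
    MulAction.orbit (Kf T) a = (Sk T : Set (Fin 7 → ℤ)) := by
  refine Set.Subset.antisymm (orbit_sub T a ha) fun b hb => ?_
  rcases hc b hb with rfl | h | ⟨c, hcS, h1, h2⟩
  · exact MulAction.mem_orbit_self _
  · obtain ⟨w, hw, h⟩ := skew_move T a b ha hb h
    exact ⟨⟨w, hw⟩, h⟩
  · obtain ⟨w, hw, h⟩ := skew_move T a c ha hcS h1
    obtain ⟨w', hw', h'⟩ := skew_move T c b hcS hb h2
    refine ⟨⟨w' * w, mul_mem hw' hw⟩, ?_⟩
    change (w' * w) • a = b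
    rw [mul_smul, h, h']

lemma card_step (T : List (Fin 7 → ℤ)) (a : Fin 7 → ℤ) :
    Nat.card (Kf T) = (MulAction.orbit (Kf T) a).ncard * Nat.card (Kf (a :: T)) := by
  rw [← MulAction.index_stabilizer, mul_comm,
    ← Subgroup.card_mul_index (MulAction.stabilizer (Kf T) a)]
  congr 1
  refine Nat.card_congr ⟨fun w => ⟨w.1.1, ?_⟩, fun w => ⟨⟨w.1, ?_⟩, ?_⟩, fun _ => rfl, fun _ => rfl⟩
  · intro t ht
    rcases List.mem_cons.1 ht with rfl | ht
    · exact w.2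
    · exact w.1.2 t ht
  · exact fun t ht => w.2 t (List.mem_cons_of_mem _ ht)
  · exact w.2 a List.mem_cons_self

lemma s0 : (MulAction.orbit (Kf []) (fvec 6)).ncard = 27 := by
  rw [orbit_eq _ _ (by decide +kernel) (by decide +kernel), Set.ncard_coe_finset]; decide +kernel
lemma s1 : (MulAction.orbit (Kf [fvec 6]) (fvec 5)).ncard = 16 := by
  rw [orbit_eq _ _ (by decide +kernel) (by decide +kernel), Set.ncard_coe_finset]; decide +kernel
lemma s2 : (MulAction.orbit (Kf [fvec 5, fvec 6]) (fvec 4)).ncard = 10 := by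
  rw [orbit_eq _ _ (by decide +kernel) (by decide +kernel), Set.ncard_coe_finset]; decide +kernel
lemma s3 : (MulAction.orbit (Kf [fvec 4, fvec 5, fvec 6]) (fvec 3)).ncard = 6 := by
  rw [orbit_eq _ _ (by decide +kernel) (by decide +kernel), Set.ncard_coe_finset]; decide +kernel
lemma s4 : (MulAction.orbit (Kf [fvec 3, fvec 4, fvec 5, fvec 6]) (fvec 1)).ncard ≤ 3 := by
  refine (Set.ncard_le_ncard (orbit_sub _ _ (by decide +kernel)) (Finset.finite_toSet _)).trans ?_
  rw [Set.ncard_coe_finset]; decide +kernel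

lemma s5 : Nat.card (Kf [fvec 1, fvec 3, fvec 4, fvec 5, fvec 6]) = 1 := by
  rw [Nat.card_eq_one_iff_unique]
  refine ⟨⟨?_⟩, ⟨1⟩⟩
  have key : ∀ w ∈ Kf [fvec 1, fvec 3, fvec 4, fvec 5, fvec 6], w = 1 := by
    intro w hw
    have h1 : w • fvec 1 = fvec 1 := hw _ (by simp)
    have h3 : w • fvec 3 = fvec 3 := hw _ (by simp)
    have h4 : w • fvec 4 = fvec 4 := hw _ (by simp)
    have h5 : w • fvec 5 = fvec 5 := hw _ (by simp)
    have h6 : w • fvec 6 = fvec 6 := hw _ (by simp)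
    have h2 : w • fvec 2 = fvec 2 := by
      have := orbit_sub [fvec 1, fvec 3, fvec 4, fvec 5, fvec 6] (fvec 2) (by decide +kernel)
        ⟨⟨w, hw⟩, rfl⟩
      have hs : Sk [fvec 1, fvec 3, fvec 4, fvec 5, fvec 6] = {fvec 2} := by decide +kernel
      rw [hs] at this
      simpa using this
    have hk := (W_inv w).2
    have e : kvec = (-3 : ℤ) • fvec 0 + fvec 1 + fvec 2 + fvec 3 + fvec 4 + fvec 5 + fvec 6 := by
      decide +kernel
    have h0 : w • fvec 0 = fvec 0 := by
      have hk' : w.1 kvec = kvec := hk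
      change w.1 _ = _ at h1 h2 h3 h4 h5 h6
      change w.1 _ = _
      rw [e] at hk'
      simp only [map_add, map_smul, h1, h2, h3, h4, h5, h6, add_left_inj] at hk'
      exact smul_right_injective _ (by norm_num : (-3 : ℤ) ≠ 0) hk'
    apply Subtype.ext
    apply LinearEquiv.toLinearMap_injective
    refine LinearMap.pi_ext' fun i => LinearMap.ext_ring ?_
    have hs : (LinearMap.single ℤ (fun _ : Fin 7 => ℤ) i) 1 = fvec i := by
      ext j; simp [fvec, Pi.single_apply]
    change w.1 ((LinearMap.single ℤ (fun _ : Fin 7 => ℤ) i) 1) =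
      (LinearMap.single ℤ (fun _ : Fin 7 => ℤ) i) 1
    rw [hs]
    fin_cases i <;> assumption
  intro a b
  exact Subtype.ext ((key a a.2).trans (key b b.2).symm)

lemma H0_eq : H0 = Kf [fvec 6] := by
  ext w
  simp [H0, Kf]

lemma Kf_nil : Kf [] = ⊤ := by
  ext w; simp [Kf]

lemma H0_card : ∃ n, n ∈ Finset.Icc 1 3 ∧ Nat.card H0 = 960 * n := by
  refine ⟨(MulAction.orbit (Kf [fvec 3, fvec 4, fvec 5, fvec 6]) (fvec 1)).ncard, ?_, ?_⟩
  · refine Finset.mem_Icc.2 ⟨?_, s4⟩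
    exact (Set.ncard_pos ((Finset.finite_toSet _).subset
      (orbit_sub _ _ (by decide +kernel)))).2 ⟨_, MulAction.mem_orbit_self _⟩
  · rw [H0_eq, card_step _ (fvec 5), s1, card_step _ (fvec 4), s2, card_step _ (fvec 3), s3,
      card_step _ (fvec 1), s5]
    ring

lemma W_card : Nat.card WE6 = 27 * Nat.card H0 := by
  rw [H0_eq, ← s0, ← card_step, Kf_nil]
  exact (Nat.card_congr Subgroup.topEquiv.toEquiv).symm

lemma H0_pos : 0 < Nat.card H0 := by
  obtain ⟨n, h, e⟩ := H0_card
  have := Finset.mem_Icc.1 h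
  omega

lemma H0_index : H0.index = 27 := by
  have h := Subgroup.card_mul_index H0
  rw [W_card, mul_comm] at h
  exact Nat.eq_of_mul_eq_mul_right H0_pos h

lemma W_ext (a b : WE6) (h : ∀ x : Fin 7 → ℤ, a • x = b • x) : a = b :=
  Subtype.ext (LinearEquiv.ext h)

/-- Generators of a 2-subgroup. -/
def gA : WE6 := rW ![0,1,-1,0,0,0,0] (by decide +kernel)
def gA' : WE6 := rW ![1,0,0,-1,-1,-1,0] (by decide +kernel)
def gB : WE6 := rW ![0,0,0,1,-1,0,0] (by decide +kernel)
def gB' : WE6 := rW ![1,-1,-1,0,0,-1,0] (by decide +kernel)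
def gT : WE6 := rW ![0,1,0,-1,0,0,0] (by decide +kernel) * rW ![0,0,1,0,-1,0,0] (by decide +kernel)
def gV : WE6 := rW ![0,0,1,0,-1,0,0] (by decide +kernel) * rW ![1,-1,0,-1,0,-1,0] (by decide +kernel)
def gU : WE6 := rW ![0,0,0,0,1,-1,0] (by decide +kernel) * rW ![1,-1,-1,-1,0,0,0] (by decide +kernel)
/-- An element of order 5. -/
def gC : WE6 := rW ![0,1,-1,0,0,0,0] (by decide +kernel) * rW ![0,0,1,-1,0,0,0] (by decide +kernel)
  * (rW ![0,0,0,1,-1,0,0] (by decide +kernel) * rW ![0,0,0,0,1,-1,0] (by decide +kernel))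

lemma t12 (x : Fin 7 → ℤ) : reflFun ![0, 1, -1, 0, 0, 0, 0] x =
    ![x 0, x 2, x 1, x 3, x 4, x 5, x 6] := by
  ext i
  fin_cases i <;> simp [reflFun, form, Fin.sum_univ_succ] <;> ring
lemma t23 (x : Fin 7 → ℤ) : reflFun ![0, 0, 1, -1, 0, 0, 0] x =
    ![x 0, x 1, x 3, x 2, x 4, x 5, x 6] := by
  ext i
  fin_cases i <;> simp [reflFun, form, Fin.sum_univ_succ] <;> ring
lemma t34 (x : Fin 7 → ℤ) : reflFun ![0, 0, 0, 1, -1, 0, 0] x =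
    ![x 0, x 1, x 2, x 4, x 3, x 5, x 6] := by
  ext i
  fin_cases i <;> simp [reflFun, form, Fin.sum_univ_succ] <;> ring
lemma t45 (x : Fin 7 → ℤ) : reflFun ![0, 0, 0, 0, 1, -1, 0] x =
    ![x 0, x 1, x 2, x 3, x 5, x 4, x 6] := by
  ext i
  fin_cases i <;> simp [reflFun, form, Fin.sum_univ_succ] <;> ring
lemma t13 (x : Fin 7 → ℤ) : reflFun ![0, 1, 0, -1, 0, 0, 0] x =
    ![x 0, x 3, x 2, x 1, x 4, x 5, x 6] := by
  ext i
  fin_cases i <;> simp [reflFun, form, Fin.sum_univ_succ] <;> ring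
lemma t24 (x : Fin 7 → ℤ) : reflFun ![0, 0, 1, 0, -1, 0, 0] x =
    ![x 0, x 1, x 4, x 3, x 2, x 5, x 6] := by
  ext i
  fin_cases i <;> simp [reflFun, form, Fin.sum_univ_succ] <;> ring
lemma q345 (x : Fin 7 → ℤ) : reflFun ![1, 0, 0, -1, -1, -1, 0] x =
    ![2 * x 0 + x 3 + x 4 + x 5, x 1, x 2, - x 0 - x 4 - x 5, - x 0 - x 3 - x 5, - x 0 - x 3 - x 4, x 6] := by
  ext i
  fin_cases i <;> simp [reflFun, form, Fin.sum_univ_succ] <;> ring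
lemma q125 (x : Fin 7 → ℤ) : reflFun ![1, -1, -1, 0, 0, -1, 0] x =
    ![2 * x 0 + x 1 + x 2 + x 5, - x 0 - x 2 - x 5, - x 0 - x 1 - x 5, x 3, x 4, - x 0 - x 1 - x 2, x 6] := by
  ext i
  fin_cases i <;> simp [reflFun, form, Fin.sum_univ_succ] <;> ring
lemma q135 (x : Fin 7 → ℤ) : reflFun ![1, -1, 0, -1, 0, -1, 0] x =
    ![2 * x 0 + x 1 + x 3 + x 5, - x 0 - x 3 - x 5, x 2, - x 0 - x 1 - x 5, x 4, - x 0 - x 1 - x 3, x 6] := by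
  ext i
  fin_cases i <;> simp [reflFun, form, Fin.sum_univ_succ] <;> ring
lemma q123 (x : Fin 7 → ℤ) : reflFun ![1, -1, -1, -1, 0, 0, 0] x =
    ![2 * x 0 + x 1 + x 2 + x 3, - x 0 - x 2 - x 3, - x 0 - x 1 - x 3, - x 0 - x 1 - x 2, x 4, x 5, x 6] := by
  ext i
  fin_cases i <;> simp [reflFun, form, Fin.sum_univ_succ] <;> ring
lemma rA (x : Fin 7 → ℤ) : gA • x = ![x 0, x 2, x 1, x 3, x 4, x 5, x 6] := by
  simp only [gA, mul_smul, rW_smul, t12]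
  try (ext i; fin_cases i <;> simp)
lemma rB (x : Fin 7 → ℤ) : gB • x = ![x 0, x 1, x 2, x 4, x 3, x 5, x 6] := by
  simp only [gB, mul_smul, rW_smul, t34]
  try (ext i; fin_cases i <;> simp)
lemma rT (x : Fin 7 → ℤ) : gT • x = ![x 0, x 3, x 4, x 1, x 2, x 5, x 6] := by
  simp only [gT, mul_smul, rW_smul, t13, t24]
  try (ext i; fin_cases i <;> simp)
lemma rC (x : Fin 7 → ℤ) : gC • x = ![x 0, x 5, x 1, x 2, x 3, x 4, x 6] := by
  simp only [gC, mul_smul, rW_smul, t12, t23, t34, t45]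
  try (ext i; fin_cases i <;> simp)
lemma rA' (x : Fin 7 → ℤ) : gA' • x = ![2 * x 0 + x 3 + x 4 + x 5, x 1, x 2,
    - x 0 - x 4 - x 5, - x 0 - x 3 - x 5, - x 0 - x 3 - x 4, x 6] := by
  simp only [gA', mul_smul, rW_smul, q345]
  try (ext i; fin_cases i <;> simp)
lemma rB' (x : Fin 7 → ℤ) : gB' • x = ![2 * x 0 + x 1 + x 2 + x 5, - x 0 - x 2 - x 5,
    - x 0 - x 1 - x 5, x 3, x 4, - x 0 - x 1 - x 2, x 6] := by
  simp only [gB', mul_smul, rW_smul, q125]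
  try (ext i; fin_cases i <;> simp)
lemma rV (x : Fin 7 → ℤ) : gV • x = ![2 * x 0 + x 1 + x 3 + x 5, - x 0 - x 3 - x 5,
    x 4, - x 0 - x 1 - x 5, x 2, - x 0 - x 1 - x 3, x 6] := by
  simp only [gV, mul_smul, rW_smul, t24, q135]
  ext i; fin_cases i <;> simp <;> ring
lemma rU (x : Fin 7 → ℤ) : gU • x = ![2 * x 0 + x 1 + x 2 + x 3, - x 0 - x 2 - x 3,
    - x 0 - x 1 - x 3, - x 0 - x 1 - x 2, x 5, x 4, x 6] := by
  simp only [gU, mul_smul, rW_smul, t45, q123]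
  ext i; fin_cases i <;> simp <;> ring

lemma C5 : gC ^ 5 = 1 := by
  refine W_ext _ _ fun x => ?_
  simp only [pow_succ, pow_zero, one_mul, mul_smul, rC, one_smul]
  ext i; fin_cases i <;> rfl

lemma C_fix : ∀ v ∈ L, (![v 0, v 5, v 1, v 2, v 3, v 4, v 6] : Fin 7 → ℤ) = v →
    v = fvec 6 ∨ v = ![2,-1,-1,-1,-1,-1,0] := by decide +kernel

lemma sqA : gA * gA = 1 := by
  refine W_ext _ _ fun x => ?_
  simp only [mul_smul, rA, one_smul]
  ext i; fin_cases i <;> simp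
lemma sqA' : gA' * gA' = 1 := by
  refine W_ext _ _ fun x => ?_
  simp only [mul_smul, rA', one_smul]
  ext i; fin_cases i <;> simp <;> ring
lemma sqB : gB * gB = 1 := by
  refine W_ext _ _ fun x => ?_
  simp only [mul_smul, rB, one_smul]
  ext i; fin_cases i <;> simp
lemma sqB' : gB' * gB' = 1 := by
  refine W_ext _ _ fun x => ?_
  simp only [mul_smul, rB', one_smul]
  ext i; fin_cases i <;> simp <;> ring
lemma sqT : gT * gT = 1 := by
  refine W_ext _ _ fun x => ?_
  simp only [mul_smul, rT, one_smul]
  ext i; fin_cases i <;> simp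
lemma sqV : gV * gV = 1 := by
  refine W_ext _ _ fun x => ?_
  simp only [mul_smul, rV, one_smul]
  ext i; fin_cases i <;> simp <;> ring
lemma sqU : gU * gU = 1 := by
  refine W_ext _ _ fun x => ?_
  simp only [mul_smul, rU, one_smul]
  ext i; fin_cases i <;> simp <;> ring

lemma two_step (S : Set WE6) (g : WE6) (hg : g * g = 1)
    (h : ∀ s ∈ S, ∃ s' ∈ Subgroup.closure S, g * s = s' * g)
    (hS : IsPGroup 2 (Subgroup.closure S)) : IsPGroup 2 (Subgroup.closure (insert g S)) := by
  have hi : g⁻¹ = g := inv_eq_of_mul_eq_one_left hg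
  have hconj : ∀ x ∈ Subgroup.closure S, g * x * g⁻¹ ∈ Subgroup.closure S := by
    intro x hx
    induction hx using Subgroup.closure_induction with
    | mem s hs =>
      obtain ⟨s', hs', e⟩ := h s hs
      rw [e, mul_inv_cancel_right]; exact hs'
    | one => simp
    | mul a b _ _ ha hb => have := mul_mem ha hb; simpa [mul_assoc] using this
    | inv a _ ha => have := inv_mem ha; simpa [mul_assoc] using this
  have hn : g ∈ Subgroup.normalizer (Subgroup.closure S : Set WE6) := by
    rw [Subgroup.mem_normalizer_iff]
    intro x
    refine ⟨hconj x, fun hx => ?_⟩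
    have := hconj _ hx
    rw [hi] at this
    rwa [show g * (g * x * g) * g = (g * g) * x * (g * g) by group, hg, one_mul, mul_one] at this
  have hz : IsPGroup 2 (Subgroup.zpowers g) := by
    rintro ⟨_, k, rfl⟩
    refine ⟨1, Subtype.ext ?_⟩
    change (g ^ k) ^ 2 ^ 1 = 1
    rw [pow_one, ← zpow_natCast, zpow_comm, zpow_natCast, pow_two, hg, one_zpow]
  rw [Set.insert_eq, Subgroup.closure_union, ← Subgroup.zpowers_eq_closure]
  exact hz.to_sup_of_normal_right' hS ((Subgroup.zpowers_le).2 hn)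

/-- The 2-group. -/
def P2 : Subgroup WE6 := Subgroup.closure {gU, gT, gV, gB', gB, gA', gA}

lemma P2_two : IsPGroup 2 P2 := by
  have hM : ∀ (S : Set WE6) (x : WE6), x ∈ S → x ∈ Subgroup.closure S :=
    fun S x hx => Subgroup.subset_closure hx
  refine two_step _ _ sqU ?_ (two_step _ _ sqT ?_ (two_step _ _ sqV ?_ (two_step _ _ sqB' ?_
    (two_step _ _ sqB ?_ (two_step _ _ sqA' ?_ ?_)))))
  · rintro s (rfl | rfl | rfl | rfl | rfl | rfl)
    · refine ⟨gT * gV, mul_mem (hM _ _ (by simp)) (hM _ _ (by simp)), W_ext _ _ fun x => ?_⟩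
      simp only [mul_smul, rU, rT, rV]
      ext i; fin_cases i <;> simp <;> ring
    · refine ⟨gV, hM _ _ (by simp), W_ext _ _ fun x => ?_⟩
      simp only [mul_smul, rU, rV]
      ext i; fin_cases i <;> simp <;> ring
    · refine ⟨gB, hM _ _ (by simp), W_ext _ _ fun x => ?_⟩
      simp only [mul_smul, rU, rB, rB']
      ext i; fin_cases i <;> simp <;> ring
    · refine ⟨gB', hM _ _ (by simp), W_ext _ _ fun x => ?_⟩
      simp only [mul_smul, rU, rB, rB']
      ext i; fin_cases i <;> simp <;> ring
    · refine ⟨gA', hM _ _ (by simp), W_ext _ _ fun x => ?_⟩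
      simp only [mul_smul, rU, rA']
      ext i; fin_cases i <;> simp <;> ring
    · refine ⟨gA, hM _ _ (by simp), W_ext _ _ fun x => ?_⟩
      simp only [mul_smul, rU, rA]
      ext i; fin_cases i <;> simp <;> ring
  · rintro s (rfl | rfl | rfl | rfl | rfl)
    · refine ⟨gV, hM _ _ (by simp), W_ext _ _ fun x => ?_⟩
      simp only [mul_smul, rT, rV]
      ext i; fin_cases i <;> simp <;> ring
    · refine ⟨gA', hM _ _ (by simp), W_ext _ _ fun x => ?_⟩
      simp only [mul_smul, rT, rA', rB']
      ext i; fin_cases i <;> simp <;> ring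
    · refine ⟨gA, hM _ _ (by simp), W_ext _ _ fun x => ?_⟩
      simp only [mul_smul, rT, rA, rB]
      ext i; fin_cases i <;> simp
    · refine ⟨gB', hM _ _ (by simp), W_ext _ _ fun x => ?_⟩
      simp only [mul_smul, rT, rA', rB']
      ext i; fin_cases i <;> simp <;> ring
    · refine ⟨gB, hM _ _ (by simp), W_ext _ _ fun x => ?_⟩
      simp only [mul_smul, rT, rA, rB]
      ext i; fin_cases i <;> simp
  · rintro s (rfl | rfl | rfl | rfl)
    · refine ⟨gB, hM _ _ (by simp), W_ext _ _ fun x => ?_⟩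
      simp only [mul_smul, rV, rB, rB']
      ext i; fin_cases i <;> simp <;> ring
    · refine ⟨gB', hM _ _ (by simp), W_ext _ _ fun x => ?_⟩
      simp only [mul_smul, rV, rB, rB']
      ext i; fin_cases i <;> simp <;> ring
    · refine ⟨gA, hM _ _ (by simp), W_ext _ _ fun x => ?_⟩
      simp only [mul_smul, rV, rA, rA']
      ext i; fin_cases i <;> simp <;> ring
    · refine ⟨gA', hM _ _ (by simp), W_ext _ _ fun x => ?_⟩
      simp only [mul_smul, rV, rA, rA']
      ext i; fin_cases i <;> simp <;> ring
  · rintro s (rfl | rfl | rfl)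
    · refine ⟨gB, hM _ _ (by simp), W_ext _ _ fun x => ?_⟩
      simp only [mul_smul, rB, rB']
      ext i; fin_cases i <;> simp <;> ring
    · refine ⟨gA', hM _ _ (by simp), W_ext _ _ fun x => ?_⟩
      simp only [mul_smul, rA', rB']
      ext i; fin_cases i <;> simp <;> ring
    · refine ⟨gA, hM _ _ (by simp), W_ext _ _ fun x => ?_⟩
      simp only [mul_smul, rA, rB']
      ext i; fin_cases i <;> simp <;> ring
  · rintro s (rfl | rfl)
    · refine ⟨gA', hM _ _ (by simp), W_ext _ _ fun x => ?_⟩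
      simp only [mul_smul, rA', rB]
      ext i; fin_cases i <;> simp <;> ring
    · refine ⟨gA, hM _ _ (by simp), W_ext _ _ fun x => ?_⟩
      simp only [mul_smul, rA, rB]
      ext i; fin_cases i <;> simp
  · rintro s rfl
    refine ⟨gA, hM _ _ (by simp), W_ext _ _ fun x => ?_⟩
    simp only [mul_smul, rA, rA']
    ext i; fin_cases i <;> simp <;> ring
  · have := two_step ∅ gA sqA (by simp) (by rw [Subgroup.closure_empty]; exact IsPGroup.of_bot)
    rwa [insert_empty_eq] at this

/-- Images of a vector under the generators. -/
def nb (x : Fin 7 → ℤ) : List (Fin 7 → ℤ) :=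
  [![x 0, x 2, x 1, x 3, x 4, x 5, x 6], ![x 0, x 1, x 2, x 4, x 3, x 5, x 6],
   ![x 0, x 3, x 4, x 1, x 2, x 5, x 6],
   ![2 * x 0 + x 3 + x 4 + x 5, x 1, x 2, - x 0 - x 4 - x 5, - x 0 - x 3 - x 5,
     - x 0 - x 3 - x 4, x 6],
   ![2 * x 0 + x 1 + x 2 + x 5, - x 0 - x 2 - x 5, - x 0 - x 1 - x 5, x 3, x 4,
     - x 0 - x 1 - x 2, x 6],
   ![2 * x 0 + x 1 + x 3 + x 5, - x 0 - x 3 - x 5, x 4, - x 0 - x 1 - x 5, x 2,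
     - x 0 - x 1 - x 3, x 6],
   ![2 * x 0 + x 1 + x 2 + x 3, - x 0 - x 2 - x 3, - x 0 - x 1 - x 3, - x 0 - x 1 - x 2,
     x 5, x 4, x 6]]

lemma nb_P (x y : Fin 7 → ℤ) (h : y ∈ nb x) : ∃ g ∈ P2, g • x = y := by
  have hM : ∀ x ∈ ({gU, gT, gV, gB', gB, gA', gA} : Set WE6), x ∈ P2 :=
    fun x hx => Subgroup.subset_closure hx
  simp only [nb, List.mem_cons, List.not_mem_nil, or_false] at h
  rcases h with rfl | rfl | rfl | rfl | rfl | rfl | rfl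
  · exact ⟨gA, hM _ (by simp), rA x⟩
  · exact ⟨gB, hM _ (by simp), rB x⟩
  · exact ⟨gT, hM _ (by simp), rT x⟩
  · exact ⟨gA', hM _ (by simp), rA' x⟩
  · exact ⟨gB', hM _ (by simp), rB' x⟩
  · exact ⟨gV, hM _ (by simp), rV x⟩
  · exact ⟨gU, hM _ (by simp), rU x⟩

/-- Vectors reachable by at most `n` steps. -/
def reach : ℕ → (Fin 7 → ℤ) → Finset (Fin 7 → ℤ)
  | 0, x => {x}
  | n + 1, x => reach n x ∪ ((L.filter fun y => ∃ z ∈ reach n x, y ∈ nb z))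

lemma reach_P (n : ℕ) (x y : Fin 7 → ℤ) (h : y ∈ reach n x) : ∃ g ∈ P2, g • x = y := by
  induction n generalizing y with
  | zero => exact ⟨1, one_mem _, by rw [one_smul]; exact (Finset.mem_singleton.1 h).symm⟩
  | succ n ih =>
    rcases Finset.mem_union.1 h with h | h
    · exact ih y h
    · obtain ⟨-, z, hz, hy⟩ := Finset.mem_filter.1 h
      obtain ⟨g, hg, rfl⟩ := ih z hz
      obtain ⟨g', hg', rfl⟩ := nb_P _ y hy
      exact ⟨g' * g, mul_mem hg' hg, mul_smul _ _ _⟩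

lemma orbits : L = (reach 0 (fvec 6) ∪ (reach 1 ![1,0,0,0,0,-1,-1])) ∪
    (reach 3 ![1,-1,0,0,0,0,-1] ∪ reach 4 (fvec 5)) := by decide +kernel
lemma c0 : (reach 0 (fvec 6)).card = 1 := by decide +kernel
lemma c1 : (reach 1 ![1,0,0,0,0,-1,-1]).card = 2 := by decide +kernel
lemma c2 : (reach 3 ![1,-1,0,0,0,0,-1]).card = 8 := by decide +kernel
lemma c3 : (reach 4 (fvec 5)).card = 16 := by decide +kernel

lemma d01 : reach 0 (fvec 6) ∩ reach 1 ![1,0,0,0,0,-1,-1] = ∅ := by decide +kernel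
lemma d23 : reach 3 ![1,-1,0,0,0,0,-1] ∩ reach 4 (fvec 5) = ∅ := by decide +kernel
lemma d03 : (reach 0 (fvec 6) ∪ (reach 1 ![1,0,0,0,0,-1,-1])) ∩
    (reach 3 ![1,-1,0,0,0,0,-1] ∪ reach 4 (fvec 5)) = ∅ := by decide +kernel

lemma card_filter_union (A B : Finset (Fin 7 → ℤ)) (p : (Fin 7 → ℤ) → Prop) [DecidablePred p]
    (h : A ∩ B = ∅) : ((A ∪ B).filter p).card = (A.filter p).card + (B.filter p).card := by
  rw [Finset.filter_union, Finset.card_union_of_disjoint]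
  exact Finset.disjoint_filter_filter (Finset.disjoint_iff_inter_eq_empty.2 h)

lemma part_card (p : (Fin 7 → ℤ) → Prop) [DecidablePred p]
    (hp : ∀ g ∈ P2, ∀ x, p (g • x) ↔ p x) (n : ℕ) (x : Fin 7 → ℤ) :
    ((reach n x).filter p).card = if p x then (reach n x).card else 0 := by
  split_ifs with h
  · rw [Finset.filter_true_of_mem]
    intro y hy
    obtain ⟨g, hg, rfl⟩ := reach_P n x y hy
    exact (hp g hg x).2 h
  · rw [Finset.filter_false_of_mem, Finset.card_empty]
    intro y hy
    obtain ⟨g, hg, rfl⟩ := reach_P n x y hy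
    exact fun h' => h ((hp g hg x).1 h')

lemma W_finite : Finite WE6 := by
  apply Nat.finite_of_card_ne_zero
  rw [W_card]
  have := H0_pos
  omega

lemma C_conj (H : Subgroup WE6) (hi : H.index = 27) : ∃ g : WE6, g⁻¹ * gC * g ∈ H := by
  have h5 : IsPGroup 5 (Subgroup.zpowers gC) := by
    rintro ⟨_, k, rfl⟩
    refine ⟨1, Subtype.ext ?_⟩
    change (gC ^ k) ^ 5 ^ 1 = 1
    rw [pow_one, ← zpow_natCast, zpow_comm, zpow_natCast, C5, one_zpow]
  have : Fact (Nat.Prime 5) := ⟨by norm_num⟩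
  obtain ⟨q, hq⟩ := h5.nonempty_fixed_point_of_prime_not_dvd_card (WE6 ⧸ H)
    (by rw [← Subgroup.index_eq_card, hi]; norm_num)
  obtain ⟨g, rfl⟩ := QuotientGroup.mk_surjective q
  refine ⟨g, ?_⟩
  have h := hq ⟨gC, Subgroup.mem_zpowers gC⟩
  have h' : ((gC * g : WE6) : WE6 ⧸ H) = g := h
  have := QuotientGroup.eq.1 h'.symm
  rwa [← mul_assoc] at this

lemma P_conj (H : Subgroup WE6) (hi : H.index = 27) :
    ∃ g : WE6, P2 ≤ Subgroup.map (MulAut.conj g).toMonoidHom H := by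
  obtain ⟨q, hq⟩ := P2_two.nonempty_fixed_point_of_prime_not_dvd_card (WE6 ⧸ H)
    (by rw [← Subgroup.index_eq_card, hi]; norm_num)
  obtain ⟨g, rfl⟩ := QuotientGroup.mk_surjective q
  refine ⟨g, fun p hp => ?_⟩
  have h' : ((p * g : WE6) : WE6 ⧸ H) = g := hq ⟨p, hp⟩
  have := QuotientGroup.eq.1 h'.symm
  refine ⟨_, this, ?_⟩
  change g * (g⁻¹ * (p * g)) * g⁻¹ = p
  group

lemma bools (a b c : Prop) [Decidable a] [Decidable b] [Decidable c] :
    ∃ i j k : Bool, 1 + (if a then 2 else 0) + ((if b then 8 else 0) + (if c then 16 else 0)) =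
      1 + 2 * i.toNat + 8 * j.toNat + 16 * k.toNat := by
  refine ⟨decide a, decide b, decide c, ?_⟩
  by_cases h1 : a <;> by_cases h2 : b <;> by_cases h3 : c <;> simp [h1, h2, h3]

lemma orbit_size (H : Subgroup WE6) (hP : P2 ≤ H) :
    ∃ i j k : Bool, (MulAction.orbit H (fvec 6)).ncard =
      1 + 2 * i.toNat + 8 * j.toNat + 16 * k.toNat := by
  classical
  have hp : ∀ g ∈ P2, ∀ x, g • x ∈ MulAction.orbit H (fvec 6) ↔ x ∈ MulAction.orbit H (fvec 6) :=
    fun g hg x => ⟨fun h => by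
      have := MulAction.mem_orbit_of_mem_orbit (⟨g, hP hg⟩ : H)⁻¹ h
      have e : (⟨g, hP hg⟩ : H)⁻¹ • g • x = x := inv_smul_smul g x
      rwa [e] at this, fun h => MulAction.mem_orbit_of_mem_orbit (⟨g, hP hg⟩ : H) h⟩
  have hO : MulAction.orbit H (fvec 6) =
      (L.filter (fun x => x ∈ MulAction.orbit H (fvec 6)) : Set (Fin 7 → ℤ)) := by
    ext x
    rw [Finset.mem_coe, Finset.mem_filter, iff_and_self]
    rintro ⟨w, rfl⟩
    exact W_L w.1 _ (by decide +kernel)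
  have hself : fvec 6 ∈ MulAction.orbit H (fvec 6) := MulAction.mem_orbit_self _
  rw [hO, Set.ncard_coe_finset, orbits, card_filter_union _ _ _ d03, card_filter_union _ _ _ d01,
    card_filter_union _ _ _ d23, part_card _ hp, part_card _ hp, part_card _ hp, part_card _ hp,
    c0, c1, c2, c3, if_pos hself]
  exact bools _ _ _

lemma orbit_mod (H : Subgroup WE6) (hi : H.index = 27) :
    ∃ m ≤ 2, (MulAction.orbit H (fvec 6)).ncard ≡ m [MOD 5] := by
  have := W_finite
  obtain ⟨g, hg⟩ := C_conj H hi
  let c : H := ⟨g⁻¹ * gC * g, hg⟩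
  have hc : c ^ 5 = 1 := by
    apply Subtype.ext
    change (g⁻¹ * gC * g) ^ 5 = 1
    have := conj_pow (i := 5) (a := g⁻¹) (b := gC)
    rw [inv_inv] at this
    rw [this, C5]; group
  have h5 : IsPGroup 5 (Subgroup.zpowers c) := by
    rintro ⟨_, k, rfl⟩
    refine ⟨1, Subtype.ext ?_⟩
    change (c ^ k) ^ 5 ^ 1 = 1
    rw [pow_one, ← zpow_natCast, zpow_comm, zpow_natCast, hc, one_zpow]
  have : Fact (Nat.Prime 5) := ⟨by norm_num⟩
  have : Finite (MulAction.orbit H (fvec 6)) := Set.finite_range (fun m : H => m • fvec 6)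
  refine ⟨_, ?_, h5.card_modEq_card_fixedPoints (MulAction.orbit H (fvec 6))⟩
  have hcard : ({fvec 6, ![2,-1,-1,-1,-1,-1,0]} : Finset (Fin 7 → ℤ)).card = 2 := by
    decide +kernel
  rw [← hcard, ← Nat.card_eq_finsetCard]
  refine Nat.card_le_card_of_injective (fun v => ⟨g • v.1.1, ?_⟩) ?_
  · obtain ⟨⟨_, w, rfl⟩, hv⟩ := v
    have h1 := congrArg Subtype.val (hv ⟨c, Subgroup.mem_zpowers c⟩)
    set x := (fun m : H => m • fvec 6) w with hx
    have hxL : x ∈ L := W_L w.1 _ (by decide +kernel)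
    have h2 : (g⁻¹ * gC * g) • x = x := h1
    rw [mul_smul, mul_smul, inv_smul_eq_iff, rC] at h2
    have := C_fix _ (W_L g x hxL) h2
    simpa using this
  · intro a b hab
    have : g • a.1.1 = g • b.1.1 := congrArg Subtype.val hab
    exact Subtype.ext (Subtype.ext (smul_left_cancel g this))

lemma uniq (H : Subgroup WE6) (hi : H.index = 27) (hP : P2 ≤ H) : H = H0 := by
  have := W_finite
  have hcard : Nat.card H = Nat.card H0 := by
    have h := Subgroup.card_mul_index H
    rw [W_card, hi, mul_comm] at h
    omega
  obtain ⟨n, hn, e⟩ := H0_card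
  have hd : (MulAction.orbit H (fvec 6)).ncard ∣ 960 * n := by
    rw [← e, ← hcard, ← MulAction.index_stabilizer]
    exact Subgroup.index_dvd_card _
  obtain ⟨i, j, k, hs⟩ := orbit_size H hP
  obtain ⟨m, hm, hmod⟩ := orbit_mod H hi
  have h1 : (MulAction.orbit H (fvec 6)).ncard = 1 := by
    rw [hs] at hd hmod ⊢
    obtain ⟨n1, n3⟩ := Finset.mem_Icc.1 hn
    clear hs e hcard hn
    unfold Nat.ModEq at hmod
    rcases i <;> rcases j <;> rcases k <;> simp at hd hmod ⊢ <;> omega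
  obtain ⟨a, ha⟩ := Set.ncard_eq_one.1 h1
  have h6 : fvec 6 ∈ MulAction.orbit H (fvec 6) := MulAction.mem_orbit_self _
  refine Subgroup.eq_of_le_of_card_ge (fun w hw => ?_) hcard.ge
  have h7 : w • fvec 6 ∈ MulAction.orbit H (fvec 6) := ⟨⟨w, hw⟩, rfl⟩
  rw [ha, Set.mem_singleton_iff] at h6 h7
  change w • fvec 6 = fvec 6
  rw [h7, ← h6]

theorem stmt_18 :
    (∀ w : WE6, w ∈ H0 ↔ (w : (Fin 7 → ℤ) ≃ₗ[ℤ] (Fin 7 → ℤ)) (fvec 6) = fvec 6) ∧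
    H0.index = 27 ∧
    ∀ H : Subgroup WE6, H.index = 27 →
      ∃ g : WE6, Subgroup.map (MulAut.conj g).toMonoidHom H = H0 := by
  refine ⟨fun w => Iff.rfl, H0_index, fun H hi => ?_⟩
  obtain ⟨g, hg⟩ := P_conj H hi
  exact ⟨g, uniq _ ((Subgroup.index_map_equiv H (MulAut.conj g)).trans hi) hg⟩
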